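/- For every integer N ≥ 2 there exist N distinct points x₁, …, x_N on the unit sphere S² ⊂ ℝ³ such that Σ_{i≠j} |x_i − x_j|^{-2} ≤ (N²/4)·log N + (1/4)·( 3/2 − log(2π) + γ )·N², the sum running over all ordered pairs (i,j) with i ≠ j and |·| denoting the Euclidean norm in ℝ³. In particular the minimal Riesz 2-energy 𝓔₂(N) of N points on S² satisfies 𝓔₂(N) − (N² log N)/4 ≤ (1/4)(3/2 − log(2π) + γ)N². -/

import Mathlib

open Real

/-- The set of Riesz `s`-energies of `N`-tuples of distinct points on the unit sphere
`S² ⊂ ℝ³`; its infimum is the minimal Riesz `s`-energy `𝓔_s(N)`. -/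
noncomputable def rieszEnergies (s : ℝ) (N : ℕ) : Set ℝ :=
  {e | ∃ x : Fin N → EuclideanSpace ℝ (Fin 3),
    (∀ i, ‖x i‖ = 1) ∧ Function.Injective x ∧
    e = ∑ i : Fin N, ∑ j : Fin N, if i = j then 0 else ‖x i - x j‖ ^ (-s)}

/-- Mean value of `1/(A - a cos θ - b sin θ)`. -/
lemma integral_inv_sub_cos_sin (A a b D : ℝ) (hA : 0 < A) (hD : 0 < D)
    (h : a ^ 2 + b ^ 2 = A ^ 2 - D ^ 2) :
    ∫ θ in (0:ℝ)..2 * π, (A - a * cos θ - b * sin θ)⁻¹ = 2 * π / D := by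
  set w : ℂ := ⟨a / (A + D), b / (A + D)⟩ with hw
  have hAD : 0 < A + D := by positivity
  have hwn : ‖w‖ ^ 2 = (A - D) / (A + D) := by
    rw [← Complex.normSq_eq_norm_sq, Complex.normSq_apply]
    simp only [hw]
    field_simp
    nlinarith
  have hw1 : w ∈ Metric.ball (0:ℂ) 1 := by
    have : ‖w‖ ^ 2 < 1 := by
      rw [hwn, div_lt_one hAD]; linarith
    simp only [Metric.mem_ball, dist_zero_right]
    nlinarith [norm_nonneg w]
  have key := DiffContOnCl.circleAverage_poissonKernel_smul' (f := fun _ => (1:ℂ))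
    (R := 1) (c := 0) (w := w) diffContOnCl_const hw1
  rw [Real.circleAverage_def] at key
  have e1 : ∀ θ : ℝ, ((‖circleMap 0 1 θ - 0‖ ^ 2 - ‖w - 0‖ ^ 2) /
      ‖(circleMap 0 1 θ - 0) - (w - 0)‖ ^ 2) • (1:ℂ)
      = ((D * (A - a * cos θ - b * sin θ)⁻¹ : ℝ) : ℂ) := by
    intro θ
    have h1 : ‖(circleMap 0 1 θ - 0) - (w - 0)‖ ^ 2
        = 2 * (A - a * cos θ - b * sin θ) / (A + D) := by
      rw [← Complex.normSq_eq_norm_sq, Complex.normSq_apply]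
      simp [circleMap, hw, Complex.exp_ofReal_mul_I_re, Complex.exp_ofReal_mul_I_im]
      field_simp
      have := sin_sq_add_cos_sq θ
      linear_combination (A+D)^2 * this + h
    have h2 : ‖circleMap 0 1 θ - 0‖ = 1 := by simp
    rw [h1, h2, sub_zero, hwn]
    simp only [Complex.real_smul, mul_one]
    congr 1
    have : (1:ℝ) ^ 2 - (A - D) / (A + D) = 2 * D / (A + D) := by field_simp; ring
    rw [this]
    by_cases h0 : A - a * cos θ - b * sin θ = 0
    · simp [h0]
    · field_simp
  simp_rw [e1] at key
  rw [intervalIntegral.integral_ofReal, intervalIntegral.integral_const_mul] at key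
  rw [Complex.real_smul, ← Complex.ofReal_mul] at key
  have key2 := Complex.ofReal_injective (key.trans Complex.ofReal_one.symm)
  have hpi := Real.pi_pos
  field_simp at key2 ⊢
  linarith

lemma sum_primitive_root (r : ℕ) (hr : 0 < r) (ω : ℂ) (hω : IsPrimitiveRoot ω r) (i j : ℕ)
    (hi : i < r) (hj : j < r) :
    ∑ k ∈ Finset.range r, (ω ^ k) ^ i * (starRingEnd ℂ) ((ω ^ k) ^ j)
      = if i = j then (r : ℂ) else 0 := by
  have hn : ω * (starRingEnd ℂ) ω = 1 := by
    rw [Complex.mul_conj, Complex.normSq_eq_norm_sq, hω.norm'_eq_one hr.ne']; simp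
  have e : ∀ k, (ω ^ k) ^ i * (starRingEnd ℂ) ((ω ^ k) ^ j)
      = (ω ^ i * (starRingEnd ℂ) ω ^ j) ^ k := by
    intro k
    simp only [map_pow]
    rw [mul_pow, ← pow_mul, ← pow_mul, ← pow_mul, ← pow_mul, mul_comm k i, mul_comm k j]
  simp_rw [e]
  split_ifs with hij
  · subst hij
    rw [← mul_pow, hn]; simp
  · have hne : ω ^ i * (starRingEnd ℂ) ω ^ j ≠ 1 := by
      intro hc
      apply hij
      apply hω.pow_inj hi hj
      calc ω ^ i = ω ^ i * (starRingEnd ℂ) ω ^ j * ω ^ j := by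
            rw [mul_assoc, ← mul_pow, mul_comm _ ω, hn]; simp
        _ = ω ^ j := by rw [hc, one_mul]
    rw [geom_sum_eq hne]
    have : (ω ^ i * (starRingEnd ℂ) ω ^ j) ^ r = 1 := by
      rw [mul_pow, ← pow_mul, ← pow_mul, mul_comm i, mul_comm j, pow_mul, pow_mul, ← map_pow,
        hω.pow_eq_one]; simp
    rw [this]; simp

lemma sum_mul_pow (r : ℕ) (ζ : ℂ) (h : ζ ^ r = 1) (h1 : ζ ≠ 1) :
    ∑ j ∈ Finset.range r, (j : ℂ) * ζ ^ j = r / (ζ - 1) := by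
  have h2 : ζ - 1 ≠ 0 := sub_ne_zero.mpr h1
  have gen : ∀ n : ℕ, (∑ j ∈ Finset.range n, (j : ℂ) * ζ ^ j) * (ζ - 1) ^ 2
      = n * ζ ^ n * (ζ - 1) - ζ * (ζ ^ n - 1) := by
    intro n
    induction n with
    | zero => simp
    | succ n ih =>
      rw [Finset.sum_range_succ, add_mul, ih]; push_cast; ring
  have := gen r
  rw [h] at this
  rw [eq_div_iff h2]
  apply mul_right_cancel₀ h2
  linear_combination this

lemma sum_sq_range (r : ℕ) : ∑ j ∈ Finset.range r, (j : ℝ) ^ 2 = (r:ℝ) * (r - 1) * (2 * r - 1) / 6 := by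
  induction r with
  | zero => simp
  | succ n ih => rw [Finset.sum_range_succ, ih]; push_cast; ring

lemma sum_id_range (r : ℕ) : ∑ j ∈ Finset.range r, (j : ℂ) = (r:ℂ) * (r - 1) / 2 := by
  induction r with
  | zero => simp
  | succ n ih => rw [Finset.sum_range_succ, ih]; push_cast; ring

/-- Self-energy of the `r`-th roots of unity. -/
lemma sum_inv_dist_roots (r : ℕ) (hr : 0 < r) (ω : ℂ) (hω : IsPrimitiveRoot ω r) (l : ℕ)
    (hl : l < r) :
    ∑ k ∈ Finset.range r, (‖ω ^ l - ω ^ k‖ ^ 2)⁻¹ = ((r:ℝ) ^ 2 - 1) / 12 := by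
  have hn1 : ‖ω‖ = 1 := hω.norm'_eq_one hr.ne'
  set η : ℂ := (starRingEnd ℂ) (ω ^ l) with hη
  have hηω : ω ^ l * η = 1 := by
    rw [hη, Complex.mul_conj, Complex.normSq_eq_norm_sq]; simp [hn1]
  have hηc : ∀ j, η ^ j * (starRingEnd ℂ) (η ^ j) = 1 := by
    intro j
    rw [Complex.mul_conj, Complex.normSq_eq_norm_sq]; simp [hη, hn1]
  have hηr : η ^ r = 1 := by
    rw [hη, ← map_pow, ← pow_mul, mul_comm, pow_mul, hω.pow_eq_one]; simp
  set F : ℕ → ℂ := fun k => ∑ j ∈ Finset.range r, (j : ℂ) * (η * ω ^ k) ^ j with hF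
  -- Parseval
  have pars : ∑ k ∈ Finset.range r, ‖F k‖ ^ 2 = r * ∑ j ∈ Finset.range r, (j : ℝ) ^ 2 := by
    have : ∑ k ∈ Finset.range r, F k * (starRingEnd ℂ) (F k)
        = r * ∑ j ∈ Finset.range r, (j : ℂ) ^ 2 := by
      calc ∑ k ∈ Finset.range r, F k * (starRingEnd ℂ) (F k)
          = ∑ k ∈ Finset.range r, ∑ i ∈ Finset.range r, ∑ j ∈ Finset.range r,
              ((i:ℂ) * j * η ^ i * (starRingEnd ℂ) (η ^ j)) *
              ((ω ^ k) ^ i * (starRingEnd ℂ) ((ω ^ k) ^ j)) := by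
            refine Finset.sum_congr rfl fun k _ => ?_
            simp only [hF, map_sum, map_mul, map_pow, Complex.conj_natCast]
            rw [Finset.sum_mul_sum]
            refine Finset.sum_congr rfl fun i _ => Finset.sum_congr rfl fun j _ => ?_
            ring
        _ = ∑ i ∈ Finset.range r, ∑ j ∈ Finset.range r,
              ((i:ℂ) * j * η ^ i * (starRingEnd ℂ) (η ^ j)) *
              ∑ k ∈ Finset.range r, ((ω ^ k) ^ i * (starRingEnd ℂ) ((ω ^ k) ^ j)) := by
            rw [Finset.sum_comm]
            refine Finset.sum_congr rfl fun i _ => ?_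
            rw [Finset.sum_comm]
            refine Finset.sum_congr rfl fun j _ => ?_
            rw [Finset.mul_sum]
        _ = ∑ i ∈ Finset.range r, (r:ℂ) * (i:ℂ) ^ 2 := by
            refine Finset.sum_congr rfl fun i hi => ?_
            rw [Finset.sum_eq_single i]
            · rw [sum_primitive_root r hr ω hω i i (Finset.mem_range.mp hi) (Finset.mem_range.mp hi),
                if_pos rfl]
              linear_combination (i:ℂ)^2 * r * hηc i
            · intro j hj hji
              rw [sum_primitive_root r hr ω hω i j (Finset.mem_range.mp hi) (Finset.mem_range.mp hj),
                if_neg (Ne.symm hji), mul_zero]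
            · intro h; exact absurd hi h
        _ = _ := by rw [Finset.mul_sum]
    have h2 : ((∑ k ∈ Finset.range r, ‖F k‖ ^ 2 : ℝ) : ℂ)
        = ((r * ∑ j ∈ Finset.range r, (j : ℝ) ^ 2 : ℝ) : ℂ) := by
      push_cast
      rw [← this]
      refine Finset.sum_congr rfl fun k _ => ?_
      rw [Complex.mul_conj, Complex.normSq_eq_norm_sq]; push_cast; rfl
    exact_mod_cast h2
  have hr' : (r:ℝ) ≠ 0 := by positivity
  have hFk : ∀ k ∈ Finset.range r, ‖F k‖ ^ 2 = r ^ 2 * (‖ω ^ l - ω ^ k‖ ^ 2)⁻¹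
      + if k = l then ((r:ℝ) * (r - 1) / 2) ^ 2 else 0 := by
    intro k hk
    by_cases hkl : k = l
    · subst hkl
      have : F k = (((r:ℝ) * (r - 1) / 2 : ℝ) : ℂ) := by
        simp only [hF]
        rw [mul_comm] at hηω
        simp only [hηω, one_pow, mul_one]
        rw [sum_id_range]; push_cast; ring
      rw [this, Complex.norm_real, Real.norm_eq_abs, sq_abs]
      simp
    · have hne : η * ω ^ k ≠ 1 := by
        intro hc
        apply hkl
        apply hω.pow_inj (Finset.mem_range.mp hk) hl
        calc ω ^ k = (ω ^ l * η) * ω ^ k := by rw [hηω, one_mul]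
          _ = ω ^ l := by rw [mul_assoc, hc, mul_one]
      have hp : (η * ω ^ k) ^ r = 1 := by
        rw [mul_pow, hηr, ← pow_mul, mul_comm k, pow_mul, hω.pow_eq_one]; simp
      have : F k = r / (η * ω ^ k - 1) := sum_mul_pow r _ hp hne
      have hd : ‖η * ω ^ k - 1‖ = ‖ω ^ l - ω ^ k‖ := by
        have : ω ^ l - ω ^ k = - (ω ^ l * (η * ω ^ k - 1)) := by
          linear_combination (ω^k) * hηω
        rw [this, norm_neg, norm_mul]; simp [hn1]
      rw [this, norm_div, hd, if_neg hkl]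
      simp [mul_pow, div_eq_mul_inv]
  rw [Finset.sum_congr rfl hFk, Finset.sum_add_distrib, ← Finset.mul_sum, sum_sq_range,
    Finset.sum_ite_eq' , if_pos (Finset.mem_range.mpr hl)] at pars
  have hr2 : (r:ℝ)^2 ≠ 0 := by positivity
  apply mul_left_cancel₀ hr2
  linear_combination pars

/-- Riesz 2-energy of a finite set. -/
noncomputable def enF (S : Finset (EuclideanSpace ℝ (Fin 3))) : ℝ :=
  ∑ x ∈ S, ∑ y ∈ S, (‖x - y‖ ^ 2)⁻¹

noncomputable def spt (z φ : ℝ) : EuclideanSpace ℝ (Fin 3) :=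
  !₂[√(1 - z ^ 2) * cos φ, √(1 - z ^ 2) * sin φ, z]

lemma norm_sq_three (x : EuclideanSpace ℝ (Fin 3)) : ‖x‖ ^ 2 = x 0 ^ 2 + x 1 ^ 2 + x 2 ^ 2 := by
  rw [EuclideanSpace.norm_sq_eq, Fin.sum_univ_three]; simp

lemma spt_zero (z φ : ℝ) : spt z φ 0 = √(1 - z ^ 2) * cos φ := by simp [spt]
lemma spt_one (z φ : ℝ) : spt z φ 1 = √(1 - z ^ 2) * sin φ := by simp [spt]
lemma spt_two (z φ : ℝ) : spt z φ 2 = z := by simp [spt]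

lemma spt_norm (z φ : ℝ) (hz : z ^ 2 < 1) : ‖spt z φ‖ = 1 := by
  have h : ‖spt z φ‖ ^ 2 = 1 := by
    rw [norm_sq_three, spt_zero, spt_one, spt_two]
    have h1 := Real.sq_sqrt (show 0 ≤ 1 - z ^ 2 by linarith)
    have h2 := sin_sq_add_cos_sq φ
    linear_combination h1 * (sin φ ^ 2 + cos φ ^ 2) + (1 - z^2) * h2
  nlinarith [norm_nonneg (spt z φ)]

lemma spt_dist (z a b : ℝ) (hz : z ^ 2 < 1) :
    ‖spt z a - spt z b‖ ^ 2
      = (1 - z ^ 2) * ‖Complex.exp (a * Complex.I) - Complex.exp (b * Complex.I)‖ ^ 2 := by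
  rw [norm_sq_three, ← Complex.normSq_eq_norm_sq, Complex.normSq_apply]
  simp only [PiLp.sub_apply, spt_zero, spt_one, spt_two, Complex.sub_re, Complex.sub_im,
    Complex.exp_ofReal_mul_I_re, Complex.exp_ofReal_mul_I_im]
  have h1 := Real.sq_sqrt (show 0 ≤ 1 - z ^ 2 by linarith)
  linear_combination h1 * ((cos a - cos b) ^ 2 + (sin a - sin b) ^ 2)

lemma dist_spt (x : EuclideanSpace ℝ (Fin 3)) (hx : ‖x‖ = 1) (z φ : ℝ) (hz : z ^ 2 < 1) :
    ‖x - spt z φ‖ ^ 2 = (2 - 2 * x 2 * z) - 2 * √(1 - z ^ 2) * (x 0 * cos φ + x 1 * sin φ) := by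
  have h0 : x 0 ^ 2 + x 1 ^ 2 + x 2 ^ 2 = 1 := by rw [← norm_sq_three, hx]; norm_num
  rw [norm_sq_three]
  simp only [PiLp.sub_apply, spt_zero, spt_one, spt_two]
  have h1 := Real.sq_sqrt (show 0 ≤ 1 - z ^ 2 by linarith)
  have h2 := sin_sq_add_cos_sq φ
  linear_combination h0 + h1 * (sin φ ^ 2 + cos φ ^ 2) + (1 - z^2) * h2

lemma continuous_spt (z c : ℝ) (x : EuclideanSpace ℝ (Fin 3)) (hx : ‖x‖ = 1) (hz : z ^ 2 < 1)
    (hne : x 2 ≠ z) : Continuous fun ψ : ℝ => (‖x - spt z (ψ + c)‖ ^ 2)⁻¹ := by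
  apply Continuous.inv₀
  · simp_rw [dist_spt x hx z _ hz]; fun_prop
  · intro ψ h
    have : x - spt z (ψ + c) = 0 := by simpa using h
    apply hne
    rw [sub_eq_zero.mp this, spt_two]

lemma integral_spt (z c : ℝ) (x : EuclideanSpace ℝ (Fin 3)) (hx : ‖x‖ = 1) (hz : z ^ 2 < 1)
    (hne : x 2 ≠ z) :
    ∫ ψ in (0:ℝ)..2 * π, (‖x - spt z (ψ + c)‖ ^ 2)⁻¹ = 2 * π / (2 * |x 2 - z|) := by
  have h0 : x 0 ^ 2 + x 1 ^ 2 + x 2 ^ 2 = 1 := by rw [← norm_sq_three, hx]; norm_num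
  have h1 := Real.sq_sqrt (show 0 ≤ 1 - z ^ 2 by linarith)
  have h2 := sin_sq_add_cos_sq c
  rw [← integral_inv_sub_cos_sin (2 - 2 * x 2 * z)
    (2 * √(1 - z ^ 2) * (x 0 * cos c + x 1 * sin c))
    (2 * √(1 - z ^ 2) * (x 1 * cos c - x 0 * sin c)) (2 * |x 2 - z|)]
  · congr 1
    ext ψ
    rw [dist_spt x hx z _ hz, cos_add, sin_add]
    congr 1; ring
  · nlinarith [sq_nonneg (x 0), sq_nonneg (x 1), sq_nonneg (x 2 - z)]
  · have := abs_pos.mpr (sub_ne_zero.mpr hne); linarith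
  · rw [mul_pow _ |x 2 - z|, sq_abs]
    linear_combination 4 * h1 * (x 0 ^ 2 + x 1 ^ 2) * (sin c ^ 2 + cos c ^ 2)
      + 4 * (1 - z ^ 2) * (x 0 ^ 2 + x 1 ^ 2) * h2 + 4 * (1 - z ^ 2) * h0

lemma enF_union (S R : Finset (EuclideanSpace ℝ (Fin 3))) (h : Disjoint S R) :
    enF (S ∪ R) = enF S + enF R + 2 * ∑ x ∈ S, ∑ y ∈ R, (‖x - y‖ ^ 2)⁻¹ := by
  unfold enF
  rw [Finset.sum_union h]
  simp_rw [Finset.sum_union h, Finset.sum_add_distrib]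
  have : ∑ x ∈ R, ∑ y ∈ S, (‖x - y‖ ^ 2)⁻¹ = ∑ x ∈ S, ∑ y ∈ R, (‖x - y‖ ^ 2)⁻¹ := by
    rw [Finset.sum_comm]
    simp_rw [norm_sub_rev]
  rw [this]; ring

lemma add_ring (S : Finset (EuclideanSpace ℝ (Fin 3))) (hS : ∀ x ∈ S, ‖x‖ = 1) (z : ℝ)
    (hz : z ^ 2 < 1) (r : ℕ) (hr : 0 < r) (hne : ∀ x ∈ S, x 2 ≠ z) :
    ∃ R : Finset (EuclideanSpace ℝ (Fin 3)), (∀ y ∈ R, ‖y‖ = 1 ∧ y 2 = z) ∧ R.card = r ∧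
      Disjoint S R ∧
      enF (S ∪ R) ≤ enF S + r * ((r:ℝ) ^ 2 - 1) / (12 * (1 - z ^ 2))
        + ∑ x ∈ S, r / |x 2 - z| := by
  have hz' : 0 < 1 - z ^ 2 := by linarith
  have hpi := Real.pi_pos
  set ω : ℂ := Complex.exp (2 * π * Complex.I / r) with hω
  have hprim : IsPrimitiveRoot ω r := Complex.isPrimitiveRoot_exp r hr.ne'
  set ang : ℕ → ℝ := fun k => 2 * π * k / r with hang
  have hexp : ∀ (ψ : ℝ) (k : ℕ), Complex.exp (((ψ + ang k : ℝ) : ℂ) * Complex.I)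
      = Complex.exp (ψ * Complex.I) * ω ^ k := by
    intro ψ k
    rw [hω, ← Complex.exp_nat_mul, ← Complex.exp_add]
    congr 1
    simp only [hang]; push_cast; ring
  have hdist : ∀ (ψ : ℝ) (k l : ℕ), ‖spt z (ψ + ang k) - spt z (ψ + ang l)‖ ^ 2
      = (1 - z ^ 2) * ‖ω ^ k - ω ^ l‖ ^ 2 := by
    intro ψ k l
    rw [spt_dist z _ _ hz, hexp, hexp, ← mul_sub, norm_mul, Complex.norm_exp_ofReal_mul_I, one_mul]
  set g : ℝ → ℝ := fun ψ => ∑ x ∈ S, ∑ k ∈ Finset.range r, (‖x - spt z (ψ + ang k)‖ ^ 2)⁻¹ with hg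
  have hcont : Continuous g := by
    refine continuous_finsetSum _ fun x hx => continuous_finsetSum _ fun k _ => ?_
    exact continuous_spt z _ x (hS x hx) hz (hne x hx)
  have h_integral : ∫ ψ in (0:ℝ)..2 * π, g ψ = ∑ x ∈ S, r * (2 * π / (2 * |x 2 - z|)) := by
    simp only [hg]
    rw [intervalIntegral.integral_finsetSum]
    · refine Finset.sum_congr rfl fun x hx => ?_
      rw [intervalIntegral.integral_finsetSum]
      · rw [Finset.sum_congr rfl fun k _ => integral_spt z (ang k) x (hS x hx) hz (hne x hx)]
        simp
      · intro k _
        exact (continuous_spt z _ x (hS x hx) hz (hne x hx)).intervalIntegrable _ _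
    · intro x hx
      exact (continuous_finsetSum _ fun k _ =>
        continuous_spt z _ x (hS x hx) hz (hne x hx)).intervalIntegrable _ _
  obtain ⟨ψ, -, hψ⟩ := isCompact_Icc.exists_isMinOn
    (Set.nonempty_Icc.mpr (by positivity : (0:ℝ) ≤ 2 * π)) hcont.continuousOn
  have hle : 2 * π * g ψ ≤ ∫ t in (0:ℝ)..2 * π, g t := by
    have := intervalIntegral.integral_mono_on (a := 0) (b := 2 * π) (f := fun _ => g ψ) (g := g)
      (μ := MeasureTheory.volume)
      (by positivity) intervalIntegrable_const (hcont.intervalIntegrable _ _) (fun t ht => hψ ht)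
    simpa using this
  have hinj : Set.InjOn (fun k => spt z (ψ + ang k)) (Finset.range r : Set ℕ) := by
    intro k hk l hl hkl
    have h1 := hdist ψ k l
    simp only at hkl
    rw [hkl, sub_self] at h1
    have h2 : ‖ω ^ k - ω ^ l‖ ^ 2 = 0 := by
      have : (1 - z ^ 2) * ‖ω ^ k - ω ^ l‖ ^ 2 = 0 := by rw [← h1]; simp
      exact (mul_eq_zero.mp this).resolve_left hz'.ne'
    have h3 : ω ^ k = ω ^ l := by simpa [sub_eq_zero] using h2
    exact hprim.pow_inj (by simpa using hk) (by simpa using hl) h3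
  set R := (Finset.range r).image (fun k => spt z (ψ + ang k)) with hR
  have hRz : ∀ y ∈ R, ‖y‖ = 1 ∧ y 2 = z := by
    intro y hy
    obtain ⟨k, -, rfl⟩ := Finset.mem_image.mp hy
    exact ⟨spt_norm z _ hz, spt_two z _⟩
  have hdisj : Disjoint S R := by
    rw [Finset.disjoint_left]
    intro x hx hx'
    exact hne x hx (hRz x hx').2
  refine ⟨R, hRz, ?_, hdisj, ?_⟩
  · rw [hR, Finset.card_image_of_injOn hinj, Finset.card_range]
  · rw [enF_union S R hdisj]
    have hself : enF R = r * ((r:ℝ) ^ 2 - 1) / (12 * (1 - z ^ 2)) := by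
      unfold enF
      rw [hR, Finset.sum_image hinj]
      simp_rw [Finset.sum_image hinj, hdist, mul_inv, ← Finset.mul_sum]
      rw [Finset.sum_congr rfl fun l hl =>
        sum_inv_dist_roots r hr ω hprim l (Finset.mem_range.mp hl)]
      simp
      field_simp
    have hcross : ∑ x ∈ S, ∑ y ∈ R, (‖x - y‖ ^ 2)⁻¹ = g ψ := by
      rw [hR]; simp_rw [Finset.sum_image hinj]; rfl
    rw [hself, hcross]
    have : ∑ x ∈ S, (r:ℝ) * (2 * π / (2 * |x 2 - z|)) = π * ∑ x ∈ S, r / |x 2 - z| := by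
      rw [Finset.mul_sum]
      refine Finset.sum_congr rfl fun x hx => ?_
      have := abs_pos.mpr (sub_ne_zero.mpr (hne x hx))
      field_simp
    rw [h_integral, this] at hle
    have : 2 * g ψ ≤ ∑ x ∈ S, r / |x 2 - z| := by nlinarith
    linarith

/-- Stacks of rings. -/
lemma stack_rings (p : ℕ) (z : ℕ → ℝ) (r : ℕ → ℕ) (hz : ∀ j < p, z j ^ 2 < 1)
    (hr : ∀ j < p, 0 < r j) (hinj : ∀ j < p, ∀ k < j, z k ≠ z j) :
    ∃ S : Finset (EuclideanSpace ℝ (Fin 3)), (∀ x ∈ S, ‖x‖ = 1) ∧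
      (∀ x ∈ S, ∃ k < p, x 2 = z k) ∧
      (∀ g : ℝ → ℝ, ∑ x ∈ S, g (x 2) = ∑ k ∈ Finset.range p, r k * g (z k)) ∧
      enF S ≤ ∑ j ∈ Finset.range p, (r j * ((r j:ℝ) ^ 2 - 1) / (12 * (1 - z j ^ 2))
        + ∑ k ∈ Finset.range j, r k * (r j / |z k - z j|)) := by
  induction p with
  | zero => exact ⟨∅, by simp, by simp, by simp, by simp [enF]⟩
  | succ p ih =>
    obtain ⟨S, h1, h2, h3, h4⟩ := ih (fun j hj => hz j (by omega)) (fun j hj => hr j (by omega))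
      (fun j hj => hinj j (by omega))
    obtain ⟨R, hR1, hR2, hR3, hR4⟩ := add_ring S h1 (z p) (hz p (by omega)) (r p) (hr p (by omega))
      (fun x hx => by
        obtain ⟨k, hk, e⟩ := h2 x hx
        rw [e]; exact hinj p (by omega) k hk)
    refine ⟨S ∪ R, ?_, ?_, ?_, ?_⟩
    · intro x hx
      rcases Finset.mem_union.mp hx with hx | hx
      · exact h1 x hx
      · exact (hR1 x hx).1
    · intro x hx
      rcases Finset.mem_union.mp hx with hx | hx
      · obtain ⟨k, hk, e⟩ := h2 x hx
        exact ⟨k, by omega, e⟩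
      · exact ⟨p, by omega, (hR1 x hx).2⟩
    · intro g
      rw [Finset.sum_union hR3, Finset.sum_range_succ, h3]
      congr 1
      rw [Finset.sum_congr rfl fun x hx => by rw [(hR1 x hx).2]]
      simp [hR2]
    · rw [h3 (fun t => (r p:ℝ) / |t - z p|)] at hR4
      rw [Finset.sum_range_succ]
      linarith

/-- There are `N` points with normalized energy at most `c`. -/
def Good (N : ℕ) (c : ℝ) : Prop :=
  ∃ S : Finset (EuclideanSpace ℝ (Fin 3)), (∀ x ∈ S, ‖x‖ = 1) ∧ S.card = N ∧
    enF S ≤ c * (N * (N - 1))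

lemma Good.pred {n : ℕ} {c : ℝ} (hn : 1 ≤ n) (h : Good (n + 1) c) : Good n c := by
  obtain ⟨S, h1, h2, h3⟩ := h
  have hne : S.Nonempty := by rw [← Finset.card_pos]; omega
  obtain ⟨x, hx, hmax⟩ := S.exists_max_image (fun x => ∑ y ∈ S, (‖x - y‖ ^ 2)⁻¹) hne
  refine ⟨S.erase x, fun y hy => h1 y (Finset.mem_of_mem_erase hy), by
    rw [Finset.card_erase_of_mem hx, h2]; simp, ?_⟩
  set P := ∑ y ∈ S, (‖x - y‖ ^ 2)⁻¹ with hP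
  have hsum : enF S ≤ (n + 1) * P := by
    unfold enF
    have := Finset.sum_le_card_nsmul S (fun x => ∑ y ∈ S, (‖x - y‖ ^ 2)⁻¹) P hmax
    rw [h2] at this
    simpa using this
  have hdis : Disjoint (S.erase x) {x} := by simp
  have hu : S.erase x ∪ {x} = S := by
    rw [Finset.union_comm, ← Finset.insert_eq, Finset.insert_erase hx]
  have he := enF_union (S.erase x) {x} hdis
  rw [hu] at he
  have hPx : ∑ y ∈ S.erase x, ∑ w ∈ ({x} : Finset _), (‖y - w‖ ^ 2)⁻¹ = P := by
    rw [hP, ← Finset.add_sum_erase _ _ hx]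
    simp [norm_sub_rev]
  rw [hPx] at he
  have h0 : enF {x} = 0 := by simp [enF]
  rw [h0] at he
  have hn' : (1:ℝ) ≤ n := by exact_mod_cast hn
  push_cast at h3
  have key : (n + 1) * enF (S.erase x) ≤ (n + 1) * (c * (n * (n - 1))) := by
    have : (n - 1) * enF S ≤ (n - 1) * (c * ((n + 1) * (n + 1 - 1))) :=
      mul_le_mul_of_nonneg_left h3 (by linarith)
    nlinarith
  exact le_of_mul_le_mul_left key (by linarith)

lemma Good.mono_left {M N : ℕ} {c : ℝ} (hM : 1 ≤ M) (hMN : M ≤ N) (h : Good N c) : Good M c := by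
  induction N, hMN using Nat.le_induction with
  | base => exact h
  | succ n hn ih => exact ih (h.pred (by omega))

/-- There are `N` points with energy at most `e * N²`. -/
def Good' (N : ℕ) (e : ℝ) : Prop :=
  ∃ S : Finset (EuclideanSpace ℝ (Fin 3)), (∀ x ∈ S, ‖x‖ = 1) ∧ S.card = N ∧
    enF S ≤ e * (N:ℝ) ^ 2

lemma Good'.descend {M N : ℕ} {e : ℝ} (hM : 2 ≤ M) (hMN : M ≤ N) (he : 0 ≤ e)
    (h : Good' N e) : Good' M e := by
  obtain ⟨S, h1, h2, h3⟩ := h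
  have hM' : (2:ℝ) ≤ M := by exact_mod_cast hM
  have hMN' : (M:ℝ) ≤ N := by exact_mod_cast hMN
  have hN1 : (0:ℝ) < N - 1 := by linarith
  have hg : Good N (e * N / (N - 1)) := by
    refine ⟨S, h1, h2, h3.trans (le_of_eq ?_)⟩
    field_simp
  obtain ⟨T, t1, t2, t3⟩ := hg.mono_left (by omega) hMN
  refine ⟨T, t1, t2, t3.trans ?_⟩
  rw [div_mul_eq_mul_div, div_le_iff₀ hN1]
  have : 0 ≤ e * M * (N - M) := by
    apply mul_nonneg (by positivity); linarith
  nlinarith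

/-- partial sums of row sizes -/
def psum (r : ℕ → ℕ) (j : ℕ) : ℝ := ∑ k ∈ Finset.range j, (r k : ℝ)

lemma psum_succ (r : ℕ → ℕ) (j : ℕ) : psum r (j + 1) = psum r j + r j := by
  simp [psum, Finset.sum_range_succ]

lemma psum_mono (r : ℕ → ℕ) {i j : ℕ} (h : i ≤ j) : psum r i ≤ psum r j := by
  induction j, h using Nat.le_induction with
  | base => exact le_rfl
  | succ n hn ih => rw [psum_succ]; have : (0:ℝ) ≤ r n := by positivity
                    linarith

/-- twice the center of the j-th row -/
noncomputable def qc (r : ℕ → ℕ) (j : ℕ) : ℝ := 2 * psum r j + r j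

/-- the energy of a stack of equal area rows -/
noncomputable def rowE (r : ℕ → ℕ) (p : ℕ) : ℝ :=
  ∑ j ∈ Finset.range p,
    (psum r p ^ 2 * (r j * ((r j:ℝ) ^ 2 - 1)) / (12 * (qc r j * (2 * psum r p - qc r j)))
      + ∑ k ∈ Finset.range j, psum r p * (r j * r k / (qc r j - qc r k)))

lemma qc_lt (r : ℕ → ℕ) (p : ℕ) (hr : ∀ j < p, 0 < r j) {j k : ℕ} (hj : j < p) (hk : k < j) :
    qc r k + r k + r j ≤ qc r j := by
  have := psum_mono r (show k + 1 ≤ j from hk)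
  rw [psum_succ] at this
  unfold qc; linarith

lemma rows_exist (p : ℕ) (r : ℕ → ℕ) (hr : ∀ j < p, 0 < r j) (N : ℕ) (hN : psum r p = N) :
    ∃ S : Finset (EuclideanSpace ℝ (Fin 3)), (∀ x ∈ S, ‖x‖ = 1) ∧ S.card = N ∧
      enF S ≤ rowE r p := by
  have hr' : ∀ j < p, (0:ℝ) < r j := fun j hj => by exact_mod_cast hr j hj
  have hps : ∀ j, 0 ≤ psum r j := fun j => by unfold psum; positivity
  have hq0 : ∀ j < p, 0 < qc r j := fun j hj => by
    have := hr' j hj; have := hps j; unfold qc; linarith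
  have hq1 : ∀ j < p, qc r j < 2 * psum r p := fun j hj => by
    have := hr' j hj
    have h2 := psum_mono r (show j + 1 ≤ p from hj)
    rw [psum_succ] at h2
    unfold qc; linarith
  have hNpos : ∀ j < p, 0 < psum r p := fun j hj => by
    have := hq0 j hj; have := hq1 j hj; linarith
  set z : ℕ → ℝ := fun j => qc r j / psum r p - 1 with hz
  have hz2 : ∀ j < p, 1 - z j ^ 2 = qc r j * (2 * psum r p - qc r j) / psum r p ^ 2 := by
    intro j hj
    have := hNpos j hj
    simp only [hz]; field_simp; ring
  obtain ⟨S, h1, -, h3, h4⟩ := stack_rings p z r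
    (by
      intro j hj
      have h := hz2 j hj
      have : 0 < qc r j * (2 * psum r p - qc r j) / psum r p ^ 2 := by
        have := hNpos j hj
        exact div_pos (mul_pos (hq0 j hj) (by linarith [hq1 j hj])) (by positivity)
      linarith) hr
    (by
      intro j hj k hk h
      have h0 := hNpos j hj
      have := qc_lt r p hr hj hk
      have a1 := hr' j hj
      have a2 := hr' k (hk.trans hj)
      have : qc r k / psum r p < qc r j / psum r p :=
        div_lt_div_of_pos_right (by linarith) h0
      simp only [hz] at h
      linarith)
  refine ⟨S, h1, ?_, h4.trans (le_of_eq ?_)⟩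
  · have := h3 (fun _ => 1)
    simp only [Finset.sum_const, mul_one, nsmul_eq_mul] at this
    have h5 : (S.card : ℝ) = N := by rw [this, ← hN]; rfl
    exact_mod_cast h5
  · unfold rowE
    refine Finset.sum_congr rfl fun j hj => ?_
    have hj := Finset.mem_range.mp hj
    have h0 := hNpos j hj
    congr 1
    · rw [hz2 j hj]
      have := hq0 j hj
      have : 0 < 2 * psum r p - qc r j := by linarith [hq1 j hj]
      field_simp
    · refine Finset.sum_congr rfl fun k hk => ?_
      have hk := Finset.mem_range.mp hk
      have := qc_lt r p hr hj hk
      have a1 := hr' j hj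
      have a2 := hr' k (hk.trans hj)
      have e : z k - z j = - ((qc r j - qc r k) / psum r p) := by
        simp only [hz]; ring
      have hp : 0 < qc r j - qc r k := by linarith
      rw [e, abs_neg, abs_of_pos (by positivity)]
      field_simp

lemma two_div_le_log {d h : ℝ} (h0 : 0 < h) (hd : h < d) :
    2 * h / d ≤ log (d + h) - log (d - h) := by
  have hp : 0 < d - h := by linarith
  have := Real.le_log_one_add_of_nonneg (x := 2 * h / (d - h)) (by positivity)
  rw [← Real.log_div (by linarith) hp.ne']
  have e1 : 1 + 2 * h / (d - h) = (d + h) / (d - h) := by field_simp; ring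
  have e2 : 2 * (2 * h / (d - h)) / (2 * h / (d - h) + 2) = 2 * h / d := by
    have : 2 * h / (d - h) + 2 = 2 * d / (d - h) := by field_simp; ring
    rw [this]
    have : d ≠ 0 := by linarith
    field_simp
  rwa [e1, e2] at this

lemma below_sum (p : ℕ) (r : ℕ → ℕ) (hr : ∀ j < p, 0 < r j) (j : ℕ) (hj : j < p) :
    ∑ k ∈ Finset.range j, 2 * (r k : ℝ) / (qc r j - qc r k) ≤ log (qc r j) - log (r j) := by
  have hr' : ∀ j < p, (0:ℝ) < r j := fun j hj => by exact_mod_cast hr j hj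
  have : ∀ k ∈ Finset.range j, 2 * (r k : ℝ) / (qc r j - qc r k)
      ≤ log (qc r j - 2 * psum r k) - log (qc r j - 2 * psum r (k + 1)) := by
    intro k hk
    have hk := Finset.mem_range.mp hk
    have h1 := qc_lt r p hr hj hk
    have a1 := hr' j hj
    have a2 := hr' k (hk.trans hj)
    have := two_div_le_log (d := qc r j - qc r k) a2 (by linarith)
    rw [psum_succ]
    have e1 : qc r j - 2 * psum r k = qc r j - qc r k + r k := by simp only [qc]; ring
    have e2 : qc r j - 2 * (psum r k + r k) = qc r j - qc r k - r k := by simp only [qc]; ring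
    rwa [e1, e2]
  refine (Finset.sum_le_sum this).trans (le_of_eq ?_)
  rw [Finset.sum_range_sub' (fun k => log (qc r j - 2 * psum r k))]
  simp [psum, qc]

lemma above_sum (p : ℕ) (r : ℕ → ℕ) (hr : ∀ j < p, 0 < r j) (j : ℕ) (hj : j < p) :
    ∑ k ∈ Finset.Ico (j + 1) p, 2 * (r k : ℝ) / (qc r k - qc r j)
      ≤ log (2 * psum r p - qc r j) - log (r j) := by
  have hr' : ∀ j < p, (0:ℝ) < r j := fun j hj => by exact_mod_cast hr j hj
  have : ∀ k ∈ Finset.Ico (j + 1) p, 2 * (r k : ℝ) / (qc r k - qc r j)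
      ≤ log (2 * psum r (k + 1) - qc r j) - log (2 * psum r k - qc r j) := by
    intro k hk
    have hk := Finset.mem_Ico.mp hk
    have h1 := qc_lt r p hr hk.2 (show j < k by omega)
    have a1 := hr' j hj
    have a2 := hr' k hk.2
    have := two_div_le_log (d := qc r k - qc r j) a2 (by linarith)
    rw [psum_succ]
    have e1 : 2 * (psum r k + r k) - qc r j = qc r k - qc r j + r k := by simp only [qc]; ring
    have e2 : 2 * psum r k - qc r j = qc r k - qc r j - r k := by simp only [qc]; ring
    rwa [e1, e2]
  refine (Finset.sum_le_sum this).trans (le_of_eq ?_)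
  rw [Finset.sum_Ico_sub (fun k => log (2 * psum r k - qc r j)) (show j + 1 ≤ p from hj), psum_succ]
  congr 2
  simp only [qc]; ring

lemma rowE_le (p : ℕ) (r : ℕ → ℕ) (hr : ∀ j < p, 0 < r j)
    (hlo : ∀ j < p, psum r p / 4 * (r j:ℝ) ^ 2 ≤ qc r j * (2 * psum r p - qc r j))
    (hhi : ∀ j < p, qc r j * (2 * psum r p - qc r j) ≤ psum r p / 2 * (r j:ℝ) ^ 2) :
    rowE r p ≤ (log (psum r p / 2) + 2 / 3) / 4 * psum r p ^ 2 := by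
  have hr' : ∀ j < p, (0:ℝ) < r j := fun j hj => by exact_mod_cast hr j hj
  set N := psum r p with hN
  have hps : ∀ j, 0 ≤ psum r j := fun j => by unfold psum; positivity
  have hq0 : ∀ j < p, 0 < qc r j := fun j hj => by
    have := hr' j hj; have := hps j; unfold qc; linarith
  have hq1 : ∀ j < p, qc r j < 2 * N := fun j hj => by
    have := hr' j hj
    have h2 := psum_mono r (show j + 1 ≤ p from hj)
    rw [psum_succ] at h2
    unfold qc; linarith
  have hNpos : ∀ j < p, 0 < N := fun j hj => by
    have := hq0 j hj; have := hq1 j hj; linarith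
  set P := ∑ j ∈ Finset.range p, ∑ k ∈ Finset.range j, (r j * r k / (qc r j - qc r k) : ℝ) with hP
  have hE : rowE r p = ∑ j ∈ Finset.range p,
      (N ^ 2 * (r j * ((r j:ℝ) ^ 2 - 1)) / (12 * (qc r j * (2 * N - qc r j)))) + N * P := by
    unfold rowE
    rw [Finset.sum_add_distrib, hP, Finset.mul_sum]
    simp_rw [Finset.mul_sum]
    rfl
  have hP1 : 2 * P ≤ ∑ j ∈ Finset.range p, (r j:ℝ) * (log (qc r j) - log (r j)) := by
    rw [hP, Finset.mul_sum]
    refine Finset.sum_le_sum fun j hj => ?_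
    have hj := Finset.mem_range.mp hj
    refine le_trans (le_of_eq ?_) (mul_le_mul_of_nonneg_left (below_sum p r hr j hj) (hr' j hj).le)
    rw [Finset.mul_sum, Finset.mul_sum]
    refine Finset.sum_congr rfl fun k _ => ?_
    ring
  have hP2 : 2 * P ≤ ∑ j ∈ Finset.range p, (r j:ℝ) * (log (2 * N - qc r j) - log (r j)) := by
    have hsw : P = ∑ j ∈ Finset.range p, ∑ k ∈ Finset.Ico (j + 1) p,
        (r k * r j / (qc r k - qc r j) : ℝ) := by
      rw [hP]
      apply Finset.sum_comm'
      intro x y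
      simp only [Finset.mem_range, Finset.mem_Ico]
      omega
    rw [hsw, Finset.mul_sum]
    refine Finset.sum_le_sum fun j hj => ?_
    have hj := Finset.mem_range.mp hj
    refine le_trans (le_of_eq ?_) (mul_le_mul_of_nonneg_left (above_sum p r hr j hj) (hr' j hj).le)
    rw [Finset.mul_sum, Finset.mul_sum]
    refine Finset.sum_congr rfl fun k _ => ?_
    ring
  have hterm : ∀ j ∈ Finset.range p,
      N ^ 2 * (r j * ((r j:ℝ) ^ 2 - 1)) / (12 * (qc r j * (2 * N - qc r j)))
        + N / 4 * ((r j:ℝ) * (log (qc r j) - log (r j))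
          + (r j:ℝ) * (log (2 * N - qc r j) - log (r j)))
      ≤ r j * (N / 4 * (log (N / 2) + 2 / 3)) := by
    intro j hj
    have hj := Finset.mem_range.mp hj
    have hN0 := hNpos j hj
    have hrj := hr' j hj
    have hq := hq0 j hj
    have hq' : 0 < 2 * N - qc r j := by linarith [hq1 j hj]
    set w := qc r j * (2 * N - qc r j) / (r j:ℝ) ^ 2 with hw
    have hwpos : 0 < w := by positivity
    have hw1 : N / 4 ≤ w := by rw [hw, le_div_iff₀ (by positivity)]; exact hlo j hj
    have hw2 : w ≤ N / 2 := by rw [hw, div_le_iff₀ (by positivity)]; exact hhi j hj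
    have hqw : qc r j * (2 * N - qc r j) = w * (r j:ℝ) ^ 2 := by rw [hw]; field_simp
    have hlog : log (qc r j) + log (2 * N - qc r j) = log w + 2 * log (r j) := by
      rw [← Real.log_mul hq.ne' hq'.ne', hqw, Real.log_mul hwpos.ne' (by positivity), Real.log_pow]
      norm_num
    have hself : N ^ 2 * (r j * ((r j:ℝ) ^ 2 - 1)) / (12 * (qc r j * (2 * N - qc r j)))
        ≤ r j * (N / 4 * (N / (3 * w))) := by
      rw [hqw]
      have : (r j:ℝ) * (N / 4 * (N / (3 * w))) - N ^ 2 * (r j * ((r j:ℝ) ^ 2 - 1)) / (12 * (w * (r j:ℝ) ^ 2))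
          = N ^ 2 / (12 * w * r j) := by
        field_simp; ring
      have : 0 < N ^ 2 / (12 * w * r j) := by positivity
      linarith
    -- log inequality
    have hx0 : 0 ≤ N / (2 * w) - 1 := by
      rw [sub_nonneg, one_le_div (by positivity)]; linarith
    have hx1 : N / (2 * w) - 1 ≤ 1 := by
      have : N / (2 * w) ≤ 2 := by rw [div_le_iff₀ (by positivity)]; linarith
      linarith
    have hl := Real.le_log_one_add_of_nonneg hx0
    have hl2 : 2 / 3 * (N / (2 * w) - 1) ≤ 2 * (N / (2 * w) - 1) / (N / (2 * w) - 1 + 2) := by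
      rw [le_div_iff₀ (by linarith)]
      nlinarith
    have hl3 : log (1 + (N / (2 * w) - 1)) = log (N / 2) - log w := by
      rw [← Real.log_div (by positivity) hwpos.ne']
      congr 1; field_simp; ring
    have hl4 : N / (3 * w) = 2 / 3 * (N / (2 * w)) := by field_simp
    have hfin : N / (3 * w) + log w ≤ log (N / 2) + 2 / 3 := by rw [hl4]; linarith
    have : r j * (N / 4 * (N / (3 * w) + log w)) ≤ r j * (N / 4 * (log (N / 2) + 2 / 3)) := by
      gcongr
    have e : N / 4 * ((r j:ℝ) * (log (qc r j) - log (r j))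
          + (r j:ℝ) * (log (2 * N - qc r j) - log (r j))) = r j * (N / 4 * log w) := by
      linear_combination N / 4 * r j * hlog
    rw [e]
    linarith
  have hsum := Finset.sum_le_sum hterm
  rw [Finset.sum_add_distrib, ← Finset.mul_sum, Finset.sum_add_distrib, ← Finset.sum_mul] at hsum
  have hNs : ∑ j ∈ Finset.range p, (r j:ℝ) = N := rfl
  rw [hNs] at hsum
  have hN00 : 0 ≤ N := hps p
  have : N / 4 * (4 * P) ≤ N / 4 * (∑ j ∈ Finset.range p, (r j:ℝ) * (log (qc r j) - log (r j))
    + ∑ j ∈ Finset.range p, (r j:ℝ) * (log (2 * N - qc r j) - log (r j))) := by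
    apply mul_le_mul_of_nonneg_left _ (by positivity); linarith
  rw [hE]
  nlinarith

/-- row sizes of the family -/
def fam (a b : ℕ) (j : ℕ) : ℕ := if j < a then 4 * (j + 1) else 4 * (a + b - 1 - j)

lemma psum_fam_lo (a b j : ℕ) (hj : j ≤ a) : psum (fam a b) j = 2 * j * (j + 1) := by
  induction j with
  | zero => simp [psum]
  | succ n ih =>
    rw [psum_succ, ih (by omega), fam, if_pos (by omega)]; push_cast; ring

lemma psum_fam_hi (a b t : ℕ) (ht : t + 1 ≤ b) :
    psum (fam a b) (a + t) = 2 * a * (a + 1) + 2 * t * (2 * b - 1 - t) := by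
  induction t with
  | zero => simp [psum_fam_lo]
  | succ n ih =>
    have e : a + b - 1 - (a + n) = b - 1 - n := by omega
    rw [← add_assoc, psum_succ, ih (by omega), fam, if_neg (by omega), e]
    rw [show b - 1 - n = b - (n + 1) by omega]
    push_cast [show n + 1 ≤ b by omega]
    ring

lemma good_fam (a b N : ℕ) (ha : 1 ≤ a) (hab : a ≤ b) (hba : b ≤ a + 1)
    (hN : (N:ℝ) = 2 * a * (a + 1) + 2 * b * (b - 1)) :
    Good' N ((log (N / 2) + 2 / 3) / 4) := by
  have hr : ∀ j < a + (b - 1), 0 < fam a b j := by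
    intro j hj; unfold fam; split_ifs <;> omega
  have hp : psum (fam a b) (a + (b - 1)) = N := by
    rw [psum_fam_hi a b (b - 1) (by omega), hN]
    push_cast [show 1 ≤ b by omega]; ring
  have habR : (a:ℝ) ≤ b := by exact_mod_cast hab
  have hbaR : (b:ℝ) ≤ a + 1 := by exact_mod_cast hba
  have haR : (1:ℝ) ≤ a := by exact_mod_cast ha
  have hdata : ∀ j < a + (b - 1), ∃ i : ℝ, 0 < i ∧ 4 * i ^ 2 ≤ N ∧ (fam a b j : ℝ) = 4 * i ∧
      qc (fam a b) j * (2 * N - qc (fam a b) j) = 4 * i ^ 2 * (2 * N - 4 * i ^ 2) := by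
    intro j hj
    by_cases hja : j < a
    · have hf : (fam a b j : ℝ) = 4 * (j + 1) := by rw [fam, if_pos hja]; push_cast; ring
      have hjR : (j:ℝ) + 1 ≤ a := by exact_mod_cast hja
      have hj0 : (0:ℝ) ≤ j := by positivity
      refine ⟨j + 1, by positivity, ?_, hf, ?_⟩
      · rw [hN]; nlinarith
      · have : qc (fam a b) j = 4 * ((j:ℝ) + 1) ^ 2 := by
          rw [qc, psum_fam_lo a b j hja.le, hf]; ring
        rw [this]
    · obtain ⟨t, rfl⟩ := Nat.exists_eq_add_of_le (not_lt.mp hja)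
      have ht : t + 1 < b := by omega
      have htR : (t:ℝ) + 1 < b := by exact_mod_cast ht
      have ht0 : (0:ℝ) ≤ t := by positivity
      have hf : (fam a b (a + t) : ℝ) = 4 * (b - 1 - t) := by
        rw [fam, if_neg hja, show a + b - 1 - (a + t) = b - (t + 1) by omega]
        push_cast [show t + 1 ≤ b by omega]; ring
      refine ⟨b - 1 - t, by linarith, ?_, hf, ?_⟩
      · rw [hN]; nlinarith
      · have : qc (fam a b) (a + t) = 2 * N - 4 * ((b:ℝ) - 1 - t) ^ 2 := by
          rw [qc, psum_fam_hi a b t (by omega), hf, hN]; ring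
        rw [this]; ring
  obtain ⟨S, h1, h2, h3⟩ := rows_exist (a + (b - 1)) (fam a b) hr N hp
  refine ⟨S, h1, h2, h3.trans ?_⟩
  have := rowE_le (a + (b - 1)) (fam a b) hr
    (by
      intro j hj
      obtain ⟨i, hi, hiN, hf, hq⟩ := hdata j hj
      rw [hp, hq, hf]
      have : 0 ≤ 4 * i ^ 2 * (N - 4 * i ^ 2) := by
        apply mul_nonneg (by positivity); linarith
      nlinarith)
    (by
      intro j hj
      obtain ⟨i, hi, hiN, hf, hq⟩ := hdata j hj
      rw [hp, hq, hf]
      have : 0 ≤ 16 * i ^ 2 * i ^ 2 := by positivity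
      nlinarith)
  rwa [hp] at this

lemma log_lower (y : ℝ) (hy : 0 < y) (p q : ℕ) (hq : 0 < q)
    (h : (2.7182818286:ℝ) ^ p ≤ y ^ q) : (p:ℝ) / q ≤ log y := by
  have hq' : (0:ℝ) < q := by exact_mod_cast hq
  rw [div_le_iff₀ hq', mul_comm, ← Real.log_pow, Real.le_log_iff_exp_le (by positivity)]
  refine le_trans ?_ h
  rw [← mul_one (p:ℝ), Real.exp_nat_mul]
  exact pow_le_pow_left₀ (Real.exp_pos _).le Real.exp_one_lt_d9.le _

lemma log_two_pi_le : log (2 * π) ≤ 1.84 := by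
  rw [Real.log_le_iff_le_exp (by positivity)]
  have h1 : (2.7182818283:ℝ) ^ 46 ≤ Real.exp 1.84 ^ 25 := by
    rw [← Real.exp_nat_mul, show ((25:ℕ):ℝ) * 1.84 = ((46:ℕ):ℝ) * 1 by norm_num, Real.exp_nat_mul]
    exact pow_le_pow_left₀ (by norm_num) Real.exp_one_gt_d9.le _
  have h2 : (6.2832:ℝ) ^ 25 ≤ (2.7182818283:ℝ) ^ 46 := by norm_num
  have h3 : (6.2832:ℝ) ≤ Real.exp 1.84 :=
    le_of_pow_le_pow_left₀ (by norm_num) (Real.exp_pos _).le (h2.trans h1)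
  have := Real.pi_lt_d4
  linarith

lemma gamma_ge : (0.54:ℝ) ≤ Real.eulerMascheroniConstant := by
  have h := Real.eulerMascheroniSeq_lt_eulerMascheroniConstant 15
  have h2 : Real.eulerMascheroniSeq 15 = (harmonic 15 : ℝ) - log 16 := by
    simp only [Real.eulerMascheroniSeq]; norm_num
  have h3 : log (16:ℝ) = 4 * log 2 := by
    rw [show (16:ℝ) = 2 ^ 4 by norm_num, Real.log_pow]; norm_num
  have h4 : (harmonic 15 : ℝ) ≥ 3.318 := by
    have : harmonic 15 ≥ 3.318 := by
      simp only [harmonic, Finset.sum_range_succ, Finset.sum_range_zero]; norm_num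
    have h5 : ((3.318 : ℚ) : ℝ) ≤ (harmonic 15 : ℝ) := by exact_mod_cast this
    norm_num at h5 ⊢
  have := Real.log_two_lt_d9
  rw [h2, h3] at h
  linarith

lemma const_ge : (0.2:ℝ) ≤ 3/2 - Real.log (2*π) + Real.eulerMascheroniConstant := by
  have := gamma_ge
  have := log_two_pi_le
  linarith

lemma good_small (l : List ℕ) (N : ℕ) (T : ℝ) (hT : 0 ≤ T)
    (hr : ∀ j < l.length, 0 < l.getD j 0)
    (hN : psum (fun j => l.getD j 0) l.length = N)
    (hE : rowE (fun j => l.getD j 0) l.length ≤ T / 4 * (N:ℝ) ^ 2)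
    (M0 : ℕ) (hM0 : 2 ≤ M0) (hlog : T - 0.2 ≤ log M0) (M : ℕ) (h1 : M0 ≤ M) (h2 : M ≤ N) :
    Good' M ((log M + 0.2) / 4) := by
  obtain ⟨S, s1, s2, s3⟩ := rows_exist l.length (fun j => l.getD j 0) hr N hN
  obtain ⟨R, t1, t2, t3⟩ := Good'.descend (e := T / 4) (hM0.trans h1) h2 (by positivity)
    ⟨S, s1, s2, s3.trans hE⟩
  refine ⟨R, t1, t2, t3.trans ?_⟩
  have : log M0 ≤ log M := Real.log_le_log (by positivity) (by exact_mod_cast h1)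
  gcongr
  linarith

lemma good_all (M : ℕ) (hM : 2 ≤ M) : Good' M ((log M + 0.2) / 4) := by
  rcases Nat.lt_or_ge M 3 with h | h3
  · refine good_small [2] 2 0.5 (by norm_num) (by decide) ?_ ?_ 2 le_rfl ?_ M hM (by omega)
    · norm_num [psum, Finset.sum_range_succ]
    · norm_num [rowE, qc, psum, Finset.sum_range_succ]
    · have := log_lower 2 (by norm_num) 1 2 (by norm_num) (by norm_num)
      norm_num at this ⊢; linarith
  rcases Nat.lt_or_ge M 5 with h | h5
  · refine good_small [4] 4 1.25 (by norm_num) (by decide) ?_ ?_ 3 (by norm_num) ?_ M h3 (by omega)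
    · norm_num [psum, Finset.sum_range_succ]
    · norm_num [rowE, qc, psum, Finset.sum_range_succ]
    · have := log_lower 3 (by norm_num) 21 20 (by norm_num) (by norm_num)
      norm_num at this ⊢; linarith
  rcases Nat.lt_or_ge M 6 with h | h6
  · refine good_small [5] 5 1.6 (by norm_num) (by decide) ?_ ?_ 5 (by norm_num) ?_ M h5 (by omega)
    · norm_num [psum, Finset.sum_range_succ]
    · norm_num [rowE, qc, psum, Finset.sum_range_succ]
    · have := log_lower 5 (by norm_num) 7 5 (by norm_num) (by norm_num)
      norm_num at this ⊢; linarith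
  rcases Nat.lt_or_ge M 9 with h | h9
  · refine good_small [4, 4] 8 1.834 (by norm_num) (by decide) ?_ ?_ 6 (by norm_num) ?_ M h6
      (by omega)
    · norm_num [psum, Finset.sum_range_succ]
    · norm_num [rowE, qc, psum, Finset.sum_range_succ]
    · have := log_lower 6 (by norm_num) 33 20 (by norm_num) (by norm_num)
      norm_num at this ⊢; linarith
  rcases Nat.lt_or_ge M 15 with h | h15
  · refine good_small [4, 6, 4] 14 2.374 (by norm_num) (by decide) ?_ ?_ 9 (by norm_num) ?_ M h9
      (by omega)
    · norm_num [psum, Finset.sum_range_succ]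
    · norm_num [rowE, qc, psum, Finset.sum_range_succ]
    · have := log_lower 9 (by norm_num) 109 50 (by norm_num) (by norm_num)
      norm_num at this ⊢; linarith
  rcases Nat.lt_or_ge M 25 with h | h25
  · refine good_small [4, 8, 8, 4] 24 2.887 (by norm_num) (by decide) ?_ ?_ 15 (by norm_num) ?_ M
      h15 (by omega)
    · norm_num [psum, Finset.sum_range_succ]
    · norm_num [rowE, qc, psum, Finset.sum_range_succ]
    · have := log_lower 15 (by norm_num) 27 10 (by norm_num) (by norm_num)
      norm_num at this ⊢; linarith
  rcases Nat.lt_or_ge M 41 with h | h41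
  · refine good_small [5, 9, 12, 9, 5] 40 3.389 (by norm_num) (by decide) ?_ ?_ 25 (by norm_num) ?_
      M h25 (by omega)
    · norm_num [psum, Finset.sum_range_succ]
    · norm_num [rowE, qc, psum, Finset.sum_range_succ]
    · have := log_lower 25 (by norm_num) 16 5 (by norm_num) (by norm_num)
      norm_num at this ⊢; linarith
  rcases Nat.lt_or_ge M 65 with h | h65
  · refine good_small [4, 9, 12, 14, 12, 9, 4] 64 3.849 (by norm_num) (by decide) ?_ ?_ 41
      (by norm_num) ?_ M h41 (by omega)
    · norm_num [psum, Finset.sum_range_succ]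
    · norm_num [rowE, qc, psum, Finset.sum_range_succ]
    · have := log_lower 41 (by norm_num) 37 10 (by norm_num) (by norm_num)
      norm_num at this ⊢; linarith
  -- large M
  have hN : ∃ N : ℕ, M ≤ N ∧ 4 * N ≤ 5 * M ∧ Good' N ((log (N / 2) + 2 / 3) / 4) := by
    set m := Nat.sqrt ((M - 1) / 4) with hm
    have hm1 : m * m ≤ (M - 1) / 4 := Nat.sqrt_le _
    have hm2 : (M - 1) / 4 < (m + 1) * (m + 1) := Nat.lt_succ_sqrt _
    have hm4 : 4 ≤ m := by rw [hm, Nat.le_sqrt]; omega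
    have h1 : 4 * (m * m) + 1 ≤ M := by omega
    have h2 : M ≤ 4 * ((m + 1) * (m + 1)) := by omega
    by_cases hc : M ≤ 4 * (m * (m + 1))
    · refine ⟨4 * (m * (m + 1)), hc, by nlinarith, ?_⟩
      apply good_fam m (m + 1) _ (by omega) (by omega) (by omega)
      push_cast; ring
    · refine ⟨4 * ((m + 1) * (m + 1)), h2, by nlinarith, ?_⟩
      apply good_fam (m + 1) (m + 1) _ (by omega) (by omega) (by omega)
      push_cast; ring
  obtain ⟨N, n1, n2, n3⟩ := hN
  have hMN : (M:ℝ) ≤ N := by exact_mod_cast n1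
  have hNM : 4 * (N:ℝ) ≤ 5 * M := by exact_mod_cast n2
  have hM' : (65:ℝ) ≤ M := by exact_mod_cast h65
  have hl0 : 0 ≤ log ((N:ℝ) / 2) := Real.log_nonneg (by linarith)
  obtain ⟨R, t1, t2, t3⟩ := Good'.descend hM n1 (by positivity) n3
  refine ⟨R, t1, t2, t3.trans ?_⟩
  have h1 : log ((N:ℝ) / 2) ≤ log (M * (5 / 8)) := by
    apply Real.log_le_log (by linarith); linarith
  rw [Real.log_mul (by linarith) (by norm_num)] at h1
  have h2 : log (5 / 8 : ℝ) = - log (8 / 5) := by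
    rw [← Real.log_inv]; norm_num
  have h3 := log_lower (8 / 5) (by norm_num) 7 15 (by norm_num) (by norm_num)
  norm_num at h3
  apply mul_le_mul_of_nonneg_right _ (by positivity)
  linarith

lemma exists_points (N : ℕ) (hN : 2 ≤ N) : ∃ x : Fin N → EuclideanSpace ℝ (Fin 3),
      (∀ i, ‖x i‖ = 1) ∧ Function.Injective x ∧
      ∑ i : Fin N, ∑ j : Fin N, (if i = j then 0 else ‖x i - x j‖ ^ (-(2:ℝ))) ≤
        (N:ℝ)^2/4 * Real.log N
          + (1/4) * (3/2 - Real.log (2*π) + Real.eulerMascheroniConstant) * (N:ℝ)^2 := by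
  obtain ⟨S, h1, h2, h3⟩ := good_all N hN
  let f : Fin N ≃ S := (S.equivFinOfCardEq h2).symm
  refine ⟨fun i => f i, fun i => h1 _ (f i).2, fun i j hij => f.injective (Subtype.ext hij), ?_⟩
  have e : ∑ i : Fin N, ∑ j : Fin N,
      (if i = j then 0 else ‖(f i : EuclideanSpace ℝ (Fin 3)) - f j‖ ^ (-(2:ℝ))) = enF S := by
    have : ∀ i j : Fin N, (if i = j then 0 else
        ‖(f i : EuclideanSpace ℝ (Fin 3)) - f j‖ ^ (-(2:ℝ)))
        = (‖(f i : EuclideanSpace ℝ (Fin 3)) - f j‖ ^ 2)⁻¹ := by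
      intro i j
      split_ifs with h
      · simp [h]
      · rw [Real.rpow_neg (norm_nonneg _)]; norm_num
    simp_rw [this]
    unfold enF
    rw [← Finset.sum_coe_sort S, ← Equiv.sum_comp f]
    refine Finset.sum_congr rfl fun i _ => ?_
    rw [← Finset.sum_coe_sort S, ← Equiv.sum_comp f]
  rw [e]
  refine h3.trans ?_
  have := mul_le_mul_of_nonneg_right const_ge (sq_nonneg (N:ℝ))
  linarith

/-- For every `N ≥ 2` there are `N` distinct points on `S²` whose Riesz 2-energy is at most
`(N²/4)log N + (1/4)(3/2 − log 2π + γ)N²`; in particular the minimal Riesz 2-energy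
satisfies the same bound. -/
theorem minimal_riesz_two_energy_bound (N : ℕ) (hN : 2 ≤ N) :
    (∃ x : Fin N → EuclideanSpace ℝ (Fin 3),
      (∀ i, ‖x i‖ = 1) ∧ Function.Injective x ∧
      ∑ i : Fin N, ∑ j : Fin N, (if i = j then 0 else ‖x i - x j‖ ^ (-(2:ℝ))) ≤
        (N:ℝ)^2/4 * Real.log N
          + (1/4) * (3/2 - Real.log (2*π) + Real.eulerMascheroniConstant) * (N:ℝ)^2) ∧
    sInf (rieszEnergies 2 N) ≤
      (N:ℝ)^2/4 * Real.log N
        + (1/4) * (3/2 - Real.log (2*π) + Real.eulerMascheroniConstant) * (N:ℝ)^2 := by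
  obtain ⟨x, hx1, hx2, hx3⟩ := exists_points N hN
  refine ⟨⟨x, hx1, hx2, hx3⟩, le_trans (csInf_le ?_ ⟨x, hx1, hx2, rfl⟩) hx3⟩
  refine ⟨0, ?_⟩
  rintro e ⟨y, -, -, rfl⟩
  refine Finset.sum_nonneg fun i _ => Finset.sum_nonneg fun j _ => ?_
  split_ifs
  · exact le_rfl
  · positivity
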